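/- arXiv:1401.5394 — 3 statements merged into one kernel-verified Lean document; each statement's English description precedes it below -/
import Mathlib

section
/- For every n ≥ 1, #ht(n) ≤ #rht(n) ≤ #ht(n+1), and consequently inf{c | #rht(n) ∈ O((cn)ⁿ)} = inf{c | #ht(n) ∈ O((cn)ⁿ)}. -/
noncomputable section
open scoped Classical

/-- Nodes of history trees: finite sequences of natural numbers. -/
abbrev RNode := List ℕ

/-- A raw ordered labelled tree over `Q`: a set of nodes and a labelling. -/
structure PreHT (Q : Type*) where
  dom : Set RNode
  lab : RNode → Set Q

/-- `t` is a finite, prefix-closed and older-sibling-closed set of nodes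
containing the root. -/
def TreeClosed (t : Set RNode) : Prop :=
  t.Finite ∧ ([] : RNode) ∈ t ∧ (∀ v ∈ t, ∀ u : RNode, u <+: v → u ∈ t) ∧
    (∀ (u : RNode) (i : ℕ), u ++ [i] ∈ t → ∀ j < i, u ++ [j] ∈ t)

/-- An ordered labelled tree over `Q`: nodes labelled by non-empty subsets of
`Q` (and by `∅` outside the tree), each non-root label contained in its
parent's label, and labels of distinct siblings disjoint. -/
def IsOLT {Q : Type*} (d : PreHT Q) : Prop :=
  TreeClosed d.dom ∧
  (∀ v ∈ d.dom, d.lab v ≠ ∅) ∧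
  (∀ v ∉ d.dom, d.lab v = ∅) ∧
  (∀ (v : RNode) (i : ℕ), v ++ [i] ∈ d.dom → d.lab (v ++ [i]) ⊆ d.lab v) ∧
  (∀ (v : RNode) (i j : ℕ), i ≠ j → Disjoint (d.lab (v ++ [i])) (d.lab (v ++ [j])))

/-- A history tree: an ordered labelled tree in which every node's label
strictly contains the union of its children's labels. -/
def IsHT {Q : Type*} (d : PreHT Q) : Prop :=
  IsOLT d ∧ ∀ v ∈ d.dom, ∃ q ∈ d.lab v, ∀ i : ℕ, q ∉ d.lab (v ++ [i])

/-- A root history tree: strict containment is required only for non-root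
nodes, and the root's label equals the union of its children's labels. -/
def IsRHT {Q : Type*} (d : PreHT Q) : Prop :=
  IsOLT d ∧
  (∀ v ∈ d.dom, v ≠ [] → ∃ q ∈ d.lab v, ∀ i : ℕ, q ∉ d.lab (v ++ [i])) ∧
  d.lab [] = ⋃ i : ℕ, d.lab [i]

/-- `#ht(n)`: the number of history trees over a set with `n` states. -/
noncomputable def htCount (n : ℕ) : ℕ := Nat.card {d : PreHT (Fin n) // IsHT d}

/-- `#rht(n)`: the number of root history trees over a set with `n` states. -/
noncomputable def rhtCount (n : ℕ) : ℕ := Nat.card {d : PreHT (Fin n) // IsRHT d}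

/-- `f(n) ∈ O((c·n)ⁿ)`. -/
def BigOcn (f : ℕ → ℕ) (c : ℝ) : Prop :=
  ∃ K : ℝ, 0 < K ∧ ∀ n : ℕ, 1 ≤ n → (f n : ℝ) ≤ K * (c * n) ^ n

theorem PreHT.ext_of_lab {Q : Type*} {d e : PreHT Q} (hd : IsOLT d) (he : IsOLT e)
    (h : d.lab = e.lab) : d = e := by
  have key : ∀ f : PreHT Q, IsOLT f → f.dom = {v | f.lab v ≠ ∅} := fun f hf => by
    ext v
    exact ⟨hf.2.1 v, fun hv => by_contra fun hn => hv (hf.2.2.1 v hn)⟩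
  have hdom : d.dom = e.dom := by rw [key d hd, key e he, h]
  cases d
  cases e
  simp_all

/-- Each step down a history tree, to the child of index `i`, loses the states of the `i` older
siblings of that child, and a state of the parent that lies in no child. -/
theorem IsHT.ncard_child_add_le {Q : Type*} [Finite Q] {d : PreHT Q} (hd : IsHT d) {v : RNode}
    {i : ℕ} (hv : v ++ [i] ∈ d.dom) :
    (d.lab (v ++ [i])).ncard + i + 1 ≤ (d.lab v).ncard := by
  obtain ⟨⟨⟨-, -, hpre, hsib⟩, hne, -, hsub, hdisj⟩, hown⟩ := hd
  obtain ⟨q, hq, hq'⟩ := hown v (hpre _ hv v (List.prefix_append _ _))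
  have hsibs : ∀ m ≤ i, m ≤ (⋃ j < m, d.lab (v ++ [j])).ncard := by
    intro m hm
    induction m with
    | zero => simp
    | succ m ih =>
      have hmem : v ++ [m] ∈ d.dom := hsib v i hv m hm
      have hpos : 0 < (d.lab (v ++ [m])).ncard :=
        (Set.ncard_pos).2 (Set.nonempty_iff_ne_empty.2 (hne _ hmem))
      rw [Set.biUnion_lt_succ, Set.ncard_union_eq]
      · have := ih (by omega)
        omega
      · simp only [Set.disjoint_iUnion_left]
        exact fun j hj => hdisj v j m hj.ne
  have h₁ : ((⋃ j < i, d.lab (v ++ [j])) ∪ d.lab (v ++ [i])).ncard =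
      (⋃ j < i, d.lab (v ++ [j])).ncard + (d.lab (v ++ [i])).ncard := by
    refine Set.ncard_union_eq ?_
    simp only [Set.disjoint_iUnion_left]
    exact fun j hj => hdisj v j i hj.ne
  have h₂ : (insert q ((⋃ j < i, d.lab (v ++ [j])) ∪ d.lab (v ++ [i]))).ncard =
      ((⋃ j < i, d.lab (v ++ [j])) ∪ d.lab (v ++ [i])).ncard + 1 := by
    refine Set.ncard_insert_of_notMem ?_
    simp [hq']
  have h₃ : insert q ((⋃ j < i, d.lab (v ++ [j])) ∪ d.lab (v ++ [i])) ⊆ d.lab v := by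
    refine Set.insert_subset hq (Set.union_subset ?_ (hsub v i hv))
    exact Set.iUnion₂_subset fun j hj => hsub v j (hsib v i hv j hj)
  have := Set.ncard_le_ncard h₃
  have := hsibs i le_rfl
  omega

theorem IsHT.ncard_add_sum_add_length_le {Q : Type*} [Finite Q] {d : PreHT Q} (hd : IsHT d)
    {v : RNode} (hv : v ∈ d.dom) :
    (d.lab v).ncard + v.sum + v.length ≤ Nat.card Q := by
  induction v using List.reverseRecOn with
  | nil => simpa using Set.ncard_le_card (d.lab [])
  | append_singleton v i ih =>
    have := ih (hd.1.1.2.2.1 _ hv v (List.prefix_append _ _))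
    have := hd.ncard_child_add_le hv
    simp only [List.sum_append, List.sum_singleton, List.length_append, List.length_singleton]
    omega

theorem finite_sum_add_length_le (n : ℕ) : {v : RNode | v.sum + v.length ≤ n}.Finite := by
  refine ((List.finite_length_le (Fin (n + 1)) n).image (List.map Fin.val)).subset ?_
  intro v hv
  have hv' : v.sum + v.length ≤ n := hv
  have hlt : ∀ x ∈ v, x < n + 1 := fun x hx => by
    have := List.single_le_sum (l := v) (fun _ _ => Nat.zero_le _) x hx
    omega
  refine ⟨v.pmap Fin.mk hlt, ?_, ?_⟩
  · simp only [Set.mem_ofPred_eq, List.length_pmap]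
    omega
  · simp [List.map_pmap]

instance finite_isHT {Q : Type*} [Finite Q] : Finite {d : PreHT Q // IsHT d} := by
  let F : Set RNode := {v | v.sum + v.length ≤ Nat.card Q}
  have : Finite F := finite_sum_add_length_le _
  let restrictLab : {d : PreHT Q // IsHT d} → F → Set Q := fun d v => d.1.lab v
  refine Finite.of_injective restrictLab ?_
  rintro ⟨d, hd⟩ ⟨e, he⟩ h
  refine Subtype.ext (PreHT.ext_of_lab hd.1 he.1 (funext fun v => ?_))
  by_cases hv : v ∈ F
  · exact congrFun h ⟨v, hv⟩
  · have hnot : ∀ f : PreHT Q, IsHT f → v ∉ f.dom := fun f hf hvf => hv <| by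
      have := hf.ncard_add_sum_add_length_le hvf
      show v.sum + v.length ≤ Nat.card Q
      omega
    simp only [hd.1.2.2.1 v (hnot d hd), he.1.2.2.1 v (hnot e he)]

/-- Put a new root above `d`, with `d` as its only subtree. -/
def PreHT.addRoot {Q : Type*} (d : PreHT Q) : PreHT Q where
  dom := {v | match v with
    | [] => True
    | 0 :: w => w ∈ d.dom
    | (_ + 1) :: _ => False}
  lab
    | [] => d.lab []
    | 0 :: w => d.lab w
    | (_ + 1) :: _ => ∅

section AddRoot

variable {Q : Type*} (d : PreHT Q)

@[simp] theorem PreHT.nil_mem_addRoot : [] ∈ d.addRoot.dom := trivial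

@[simp] theorem PreHT.zero_cons_mem_addRoot (w : RNode) :
    0 :: w ∈ d.addRoot.dom ↔ w ∈ d.dom := Iff.rfl

@[simp] theorem PreHT.succ_cons_mem_addRoot (i : ℕ) (w : RNode) :
    (i + 1) :: w ∈ d.addRoot.dom ↔ False := Iff.rfl

@[simp] theorem PreHT.addRoot_lab_nil : d.addRoot.lab [] = d.lab [] := rfl

@[simp] theorem PreHT.addRoot_lab_zero_cons (w : RNode) :
    d.addRoot.lab (0 :: w) = d.lab w := rfl

@[simp] theorem PreHT.addRoot_lab_succ_cons (i : ℕ) (w : RNode) :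
    d.addRoot.lab ((i + 1) :: w) = ∅ := rfl

variable {d}

theorem IsOLT.addRoot (hd : IsOLT d) : IsOLT d.addRoot := by
  obtain ⟨⟨hfin, hroot, hpre, hsib⟩, hne, hemp, hsub, hdisj⟩ := hd
  refine ⟨⟨?_, by simp, ?_, ?_⟩, ?_, ?_, ?_, ?_⟩
  · refine ((hfin.image (List.cons 0)).insert []).subset ?_
    rintro (_ | ⟨_ | i, w⟩) hv <;> simp_all
  · rintro (_ | ⟨_ | i, w⟩) hv (_ | ⟨j, u⟩) huv <;> simp_all [List.cons_prefix_cons]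
    exact hpre w hv u huv.2
  · rintro (_ | ⟨_ | k, w⟩) (_ | i) hv j hj <;> simp_all
    exact hsib w _ hv j (by omega)
  · rintro (_ | ⟨_ | i, w⟩) hv <;> simp_all
  · rintro (_ | ⟨_ | i, w⟩) hv <;> simp_all
  · rintro (_ | ⟨_ | k, w⟩) (_ | i) hv <;> simp_all
  · rintro (_ | ⟨_ | k, w⟩) (_ | i) (_ | j) hij <;> simp_all

theorem IsHT.isRHT_addRoot (hd : IsHT d) : IsRHT d.addRoot := by
  refine ⟨hd.1.addRoot, ?_, ?_⟩
  · rintro (_ | ⟨_ | i, w⟩) hv hne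
    · exact absurd rfl hne
    · exact hd.2 w hv
    · exact hv.elim
  · ext q
    rw [Set.mem_iUnion]
    refine ⟨fun hq => ⟨0, hq⟩, ?_⟩
    rintro ⟨_ | i, hq⟩
    · exact hq
    · exact hq.elim

end AddRoot

/-- Add a new state to `d`, occurring in the label of the root only. -/
def PreHT.addState {n : ℕ} (d : PreHT (Fin n)) : PreHT (Fin (n + 1)) where
  dom := d.dom
  lab v := Fin.castSucc '' d.lab v ∪ {q | q = Fin.last n ∧ v = []}

section AddState

variable {n : ℕ} {d : PreHT (Fin n)}

theorem PreHT.castSucc_mem_addState_lab {v : RNode} {q : Fin n} :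
    q.castSucc ∈ d.addState.lab v ↔ q ∈ d.lab v := by
  simp [PreHT.addState, Fin.castSucc_ne_last]

theorem PreHT.last_mem_addState_lab {v : RNode} :
    Fin.last n ∈ d.addState.lab v ↔ v = [] := by
  simp [PreHT.addState, Fin.castSucc_ne_last]

theorem IsOLT.addState (hd : IsOLT d) : IsOLT d.addState := by
  obtain ⟨htree, hne, hemp, hsub, hdisj⟩ := hd
  refine ⟨htree, ?_, ?_, ?_, ?_⟩
  · intro v hv
    obtain ⟨q, hq⟩ := Set.nonempty_iff_ne_empty.2 (hne v hv)
    exact Set.nonempty_iff_ne_empty.1 ⟨q.castSucc, PreHT.castSucc_mem_addState_lab.2 hq⟩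
  · intro v hv
    have hv' : v ≠ [] := fun h => hv (h ▸ htree.2.1)
    simp [PreHT.addState, hemp v hv, hv']
  · intro v i hv q
    refine Fin.lastCases (fun hq => ?_) (fun q hq => ?_) q
    · simp [PreHT.last_mem_addState_lab] at hq
    · rw [PreHT.castSucc_mem_addState_lab] at hq ⊢
      exact hsub v i hv hq
  · intro v i j hij
    rw [Set.disjoint_left]
    intro q
    refine Fin.lastCases (fun hq => ?_) (fun q hq => ?_) q
    · simp [PreHT.last_mem_addState_lab] at hq
    · rw [PreHT.castSucc_mem_addState_lab] at hq ⊢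
      exact Set.disjoint_left.1 (hdisj v i j hij) hq

theorem IsRHT.isHT_addState (hd : IsRHT d) : IsHT d.addState := by
  refine ⟨hd.1.addState, fun v hv => ?_⟩
  by_cases hv' : v = []
  · exact ⟨Fin.last n, PreHT.last_mem_addState_lab.2 hv', fun i => by
      simp [PreHT.last_mem_addState_lab]⟩
  · obtain ⟨q, hq, hq'⟩ := hd.2.1 v hv hv'
    exact ⟨q.castSucc, PreHT.castSucc_mem_addState_lab.2 hq, fun i => by
      rw [PreHT.castSucc_mem_addState_lab]
      exact hq' i⟩

end AddState

theorem injective_addRoot {n : ℕ} :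
    Function.Injective fun d : {d : PreHT (Fin n) // IsHT d} =>
      (⟨d.1.addRoot, d.2.isRHT_addRoot⟩ : {d : PreHT (Fin n) // IsRHT d}) := by
  rintro ⟨d, hd⟩ ⟨e, he⟩ h
  have h' : d.addRoot = e.addRoot := congrArg Subtype.val h
  exact Subtype.ext (PreHT.ext_of_lab hd.1 he.1
    (funext fun v => congrFun (congrArg PreHT.lab h') (0 :: v)))

theorem injective_addState {n : ℕ} :
    Function.Injective fun d : {d : PreHT (Fin n) // IsRHT d} =>
      (⟨d.1.addState, d.2.isHT_addState⟩ : {d : PreHT (Fin (n + 1)) // IsHT d}) := by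
  rintro ⟨d, hd⟩ ⟨e, he⟩ h
  have h' : d.addState = e.addState := congrArg Subtype.val h
  refine Subtype.ext (PreHT.ext_of_lab hd.1 he.1 (funext fun v => ?_))
  ext q
  rw [← PreHT.castSucc_mem_addState_lab, h', PreHT.castSucc_mem_addState_lab]

instance finite_isRHT {n : ℕ} : Finite {d : PreHT (Fin n) // IsRHT d} :=
  Finite.of_injective _ injective_addState

theorem htCount_le_rhtCount (n : ℕ) : htCount n ≤ rhtCount n :=
  Nat.card_le_card_of_injective _ injective_addRoot

theorem rhtCount_le_htCount_succ (n : ℕ) : rhtCount n ≤ htCount (n + 1) :=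
  Nat.card_le_card_of_injective _ injective_addState

theorem htCount_one_pos : 0 < htCount 1 := by
  let d : PreHT (Fin 1) := ⟨{[]}, fun v => {_q | v = []}⟩
  have hd : IsHT d := by
    refine ⟨⟨⟨Set.finite_singleton _, rfl, ?_, ?_⟩, ?_, ?_, ?_, ?_⟩, ?_⟩ <;> simp +contextual [d]
  have : Nonempty {d : PreHT (Fin 1) // IsHT d} := ⟨⟨d, hd⟩⟩
  exact Nat.card_pos

theorem BigOcn.mono {f g : ℕ → ℕ} {c : ℝ} (h : ∀ n, f n ≤ g n) (hg : BigOcn g c) :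
    BigOcn f c := by
  obtain ⟨K, hK, hle⟩ := hg
  exact ⟨K, hK, fun n hn => (Nat.cast_le.2 (h n)).trans (hle n hn)⟩

theorem BigOcn.pos {f : ℕ → ℕ} {c : ℝ} (hf : 0 < f 1) (h : BigOcn f c) : 0 < c := by
  obtain ⟨K, hK, hle⟩ := h
  have h₁ := hle 1 le_rfl
  have h₂ : (0 : ℝ) < f 1 := Nat.cast_pos.2 hf
  simp only [Nat.cast_one, mul_one, pow_one] at h₁
  exact pos_of_mul_pos_right (h₂.trans_le h₁) hK.le

theorem add_one_pow_le_exp_one_mul {n : ℕ} (hn : 1 ≤ n) :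
    ((n : ℝ) + 1) ^ n ≤ Real.exp 1 * (n : ℝ) ^ n := by
  have hn' : (0 : ℝ) < n := by exact_mod_cast hn
  have h : (n : ℝ) + 1 ≤ Real.exp (1 / n) * n := by
    have := mul_le_mul_of_nonneg_right (Real.add_one_le_exp (1 / (n : ℝ))) hn'.le
    have h' : (1 / (n : ℝ) + 1) * n = n + 1 := by field_simp; ring
    linarith
  calc ((n : ℝ) + 1) ^ n ≤ (Real.exp (1 / n) * n) ^ n := by gcongr
    _ = Real.exp 1 * (n : ℝ) ^ n := by
      rw [mul_pow, ← Real.exp_nat_mul, mul_one_div_cancel hn'.ne']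

/-- Shifting the argument by one costs at most an arbitrarily small increase of the constant. -/
theorem BigOcn.of_le_succ {f g : ℕ → ℕ} {c c' : ℝ} (h : ∀ n, f n ≤ g (n + 1)) (hc : 0 < c)
    (hcc' : c < c') (hg : BigOcn g c) : BigOcn f c' := by
  obtain ⟨K, hK, hle⟩ := hg
  obtain ⟨δ, hδ, rfl⟩ : ∃ δ : ℝ, 0 < δ ∧ c' = c * (1 + δ) :=
    ⟨(c' - c) / c, div_pos (sub_pos.2 hcc') hc, by field_simp; ring⟩
  refine ⟨K * c * (1 + 1 / δ) * Real.exp 1, by positivity, fun n hn => ?_⟩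
  have hbern : 1 + (n : ℝ) * δ ≤ (1 + δ) ^ n := one_add_mul_le_pow (by linarith) n
  have hlin : (n : ℝ) + 1 ≤ (1 + 1 / δ) * (1 + δ) ^ n := by
    refine le_trans ?_ (mul_le_mul_of_nonneg_left hbern (by positivity))
    have h' : (1 + 1 / δ) * (1 + (n : ℝ) * δ) = n + 1 + (n * δ + 1 / δ) := by field_simp; ring
    have : 0 ≤ n * δ + 1 / δ := by positivity
    linarith
  calc (f n : ℝ) ≤ g (n + 1) := by exact_mod_cast h n
    _ ≤ K * (c * (n + 1)) ^ (n + 1) := by exact_mod_cast hle (n + 1) (by omega)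
    _ = K * c * c ^ n * (((n : ℝ) + 1) * ((n : ℝ) + 1) ^ n) := by
      rw [mul_pow]; ring
    _ ≤ K * c * c ^ n * (((1 + 1 / δ) * (1 + δ) ^ n) * (Real.exp 1 * (n : ℝ) ^ n)) := by
      gcongr
      exact add_one_pow_le_exp_one_mul hn
    _ = K * c * (1 + 1 / δ) * Real.exp 1 * (c * (1 + δ) * n) ^ n := by
      rw [mul_pow, mul_pow]; ring

/-- For every `n ≥ 1`, `#ht(n) ≤ #rht(n) ≤ #ht(n+1)`, and
consequently `inf{c | #rht(n) ∈ O((cn)ⁿ)} = inf{c | #ht(n) ∈ O((cn)ⁿ)}`. -/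
theorem rhtCount_growth :
    (∀ n : ℕ, 1 ≤ n → htCount n ≤ rhtCount n ∧ rhtCount n ≤ htCount (n + 1)) ∧
    sInf {c : ℝ | BigOcn rhtCount c} = sInf {c : ℝ | BigOcn htCount c} := by
  refine ⟨fun n _ => ⟨htCount_le_rhtCount n, rhtCount_le_htCount_succ n⟩, ?_⟩
  have hpos : ∀ c, BigOcn htCount c → 0 < c := fun c hc => hc.pos htCount_one_pos
  have hsub : {c : ℝ | BigOcn rhtCount c} ⊆ {c : ℝ | BigOcn htCount c} :=
    fun c hc => hc.mono htCount_le_rhtCount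
  have hshift : ∀ c c', BigOcn htCount c → c < c' → BigOcn rhtCount c' := fun c c' hc hcc' =>
    hc.of_le_succ rhtCount_le_htCount_succ (hpos c hc) hcc'
  have hbdd : BddBelow {c : ℝ | BigOcn htCount c} := ⟨0, fun c hc => (hpos c hc).le⟩
  rcases Set.eq_empty_or_nonempty {c : ℝ | BigOcn htCount c} with hemp | ⟨c₀, hc₀⟩
  · rw [hemp] at hsub ⊢
    rw [Set.subset_empty_iff.1 hsub]
  · have hne : {c : ℝ | BigOcn rhtCount c}.Nonempty := ⟨c₀ + 1, hshift c₀ _ hc₀ (by linarith)⟩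
    refine le_antisymm (le_csInf ⟨c₀, hc₀⟩ fun c hc => ?_) (csInf_le_csInf hbdd hne hsub)
    exact le_of_forall_gt_imp_ge_of_dense fun c' hcc' =>
      csInf_le (hbdd.mono hsub) (hshift c c' hc hcc')
end
end

section
/- The deterministic parity automaton obtained via the LIR construction from a nondeterministic one-pair Rabin automaton with n states has O(n!²) states, and O(n!(n−1)!) states if the input automaton is a Büchi automaton. -/
noncomputable section
open scoped Classical

/-- `v` is an older sibling of `w`. -/
def olderSibR (v w : RNode) : Prop := ∃ (u : RNode) (i j : ℕ), j < i ∧ v = u ++ [j] ∧ w = u ++ [i]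

/-- `ord` is a later introduction record (LIR) of the root history tree `d`:
it lists the non-root nodes of `d` without repetition, each node appearing
after all of its ancestors and older siblings. -/
def IsLIROfRHT {Q : Type*} (d : PreHT Q) (ord : List RNode) : Prop :=
  ord.Nodup ∧ (∀ v : RNode, v ∈ ord ↔ (v ∈ d.dom ∧ v ≠ [])) ∧
  ∀ (j : ℕ) (hj : j < ord.length) (v : RNode),
    ((v <+: ord.get ⟨j, hj⟩ ∧ v ≠ ord.get ⟨j, hj⟩ ∧ v ≠ []) ∨ olderSibR v (ord.get ⟨j, hj⟩)) →
    v ∈ d.dom →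
    ∃ (i : ℕ) (hi : i < ord.length), i < j ∧ ord.get ⟨i, hi⟩ = v

/-- The number of states of the LIR determinisation of a one-pair Rabin
automaton with `n` states: the number of RHT/LIR pairs over a set of `n`
states. -/
noncomputable def lirRhtCount (n : ℕ) : ℕ :=
  Nat.card {p : PreHT (Fin n) × List RNode // IsRHT p.1 ∧ IsLIROfRHT p.1 p.2}

/-- The number of states of the LIR determinisation of a Büchi automaton with
`n` states: the RHT/LIR pairs in which the label of the child `0` of the root
equals the label of the root (as is the case for `R = ∅`). -/
noncomputable def lirRhtBuchiCount (n : ℕ) : ℕ :=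
  Nat.card {p : PreHT (Fin n) × List RNode //
    IsRHT p.1 ∧ IsLIROfRHT p.1 p.2 ∧ p.1.lab [0] = p.1.lab []}

section Counting

/-- The number of functions from an `n`-element set to `Option α` hitting every element of an
`m`-element set `α`. -/
def partialSurjCount : ℕ → ℕ → ℕ
  | 0, m => if m = 0 then 1 else 0
  | n + 1, m => (m + 1) * partialSurjCount n m + m * partialSurjCount n (m - 1)

lemma card_partialSurj_le (n : ℕ) : ∀ (α : Type) [Fintype α],
    Nat.card {h : Fin n → Option α // ∀ a, ∃ q, h q = some a} ≤
      partialSurjCount n (Fintype.card α) := by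
  induction n with
  | zero =>
    intro α _
    rcases isEmpty_or_nonempty α with hα | ⟨⟨a⟩⟩
    · simp only [Fintype.card_eq_zero, partialSurjCount, if_true]
      exact Finite.card_le_one_iff_subsingleton.2 inferInstance
    · have : IsEmpty {h : Fin 0 → Option α // ∀ a, ∃ q, h q = some a} :=
        ⟨fun h => (h.2 a).choose.elim0⟩
      rw [Nat.card_of_isEmpty]
      exact Nat.zero_le _
  | succ n ih =>
    intro α _
    let Φ : (Option α × {h : Fin n → Option α // ∀ a, ∃ q, h q = some a}) ⊕
        (Σ a : α, {h : Fin n → Option {b // b ≠ a} // ∀ a, ∃ q, h q = some a}) →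
        (Fin (n + 1) → Option α) :=
      Sum.elim (fun x => Fin.cons x.1 x.2.1)
        (fun x => Fin.cons (some x.1) (fun q => (x.2.1 q).map Subtype.val))
    have hΦ : ∀ h : {h : Fin (n + 1) → Option α // ∀ a, ∃ q, h q = some a}, ∃ x, Φ x = h.1 := by
      rintro ⟨h, hc⟩
      by_cases ht : ∀ a, ∃ q, Fin.tail h q = some a
      · exact ⟨Sum.inl (h 0, ⟨Fin.tail h, ht⟩), Fin.cons_self_tail h⟩
      · push Not at ht
        obtain ⟨a, ha⟩ := ht
        have h0 : h 0 = some a := by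
          obtain ⟨q, hq⟩ := hc a
          rcases Fin.eq_zero_or_eq_succ q with rfl | ⟨q, rfl⟩
          · exact hq
          · exact absurd hq (ha q)
        have hex : ∀ q, ∃ y : Option {b // b ≠ a}, y.map Subtype.val = Fin.tail h q := by
          intro q
          rcases hq : Fin.tail h q with _ | b
          · exact ⟨none, rfl⟩
          · exact ⟨some ⟨b, fun hb => ha q (hb ▸ hq)⟩, rfl⟩
        choose t ht using hex
        refine ⟨Sum.inr ⟨a, t, ?_⟩, ?_⟩
        · rintro ⟨b, hb⟩
          obtain ⟨q, hq⟩ := hc b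
          rcases Fin.eq_zero_or_eq_succ q with rfl | ⟨q, rfl⟩
          · rw [h0] at hq
            exact absurd (Option.some.inj hq).symm hb
          · refine ⟨q, Option.map_injective Subtype.val_injective ?_⟩
            rw [ht]
            exact hq
        · simp only [Φ, Sum.elim_inr, ht, ← h0]
          exact Fin.cons_self_tail h
    choose f hf using hΦ
    have hinj : Function.Injective f := fun x y hxy =>
      Subtype.ext (by rw [← hf x, ← hf y, hxy])
    refine (Nat.card_le_card_of_injective f hinj).trans ?_
    rw [Nat.card_sum, Nat.card_prod, Nat.card_sigma, partialSurjCount]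
    refine Nat.add_le_add ?_ ?_
    · rw [Nat.card_eq_fintype_card, Fintype.card_option]
      exact Nat.mul_le_mul_left _ (ih α)
    · refine (Finset.sum_le_card_nsmul _ _ (partialSurjCount n (Fintype.card α - 1)) ?_).trans ?_
      · intro a _
        refine (ih {b // b ≠ a}).trans (le_of_eq ?_)
        congr 1
        simp [Fintype.card_subtype_compl]
      · simp

lemma partialSurjCount_eq_zero {n : ℕ} : ∀ {m : ℕ}, n < m → partialSurjCount n m = 0 := by
  induction n with
  | zero => intro m hm; simp [partialSurjCount]; omega
  | succ n ih =>
    intro m hm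
    simp [partialSurjCount, ih (show n < m by omega), ih (show n < m - 1 by omega)]

lemma partialSurjCount_zero_right (n : ℕ) : partialSurjCount n 0 = 1 := by
  induction n with
  | zero => rfl
  | succ n ih => simp [partialSurjCount, ih]

open Nat in
lemma partialSurjCount_mul_le (n : ℕ) :
    ∀ m, partialSurjCount n m * m ! * (n - m)! ≤ n ! * n ! := by
  induction n with
  | zero => intro m; rcases m with _ | m <;> simp [partialSurjCount]
  | succ n ih =>
    rintro (_ | m)
    · simpa [partialSurjCount_zero_right] using Nat.le_mul_self _
    rcases lt_or_ge n m with hm | hm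
    · rw [partialSurjCount_eq_zero (by omega)]
      simp
    obtain ⟨k, rfl⟩ := Nat.exists_eq_add_of_le hm
    have h1 : partialSurjCount (m + k) (m + 1) * (m + 1)! * k ! ≤
        k * ((m + k)! * (m + k)!) := by
      rcases k with _ | k
      · rw [partialSurjCount_eq_zero (by omega)]
        simp
      · have := ih (m + 1)
        rw [show m + (k + 1) - (m + 1) = k by omega] at this
        calc _ = (k + 1) * (partialSurjCount (m + (k + 1)) (m + 1) * (m + 1)! * k !) := by
              rw [Nat.factorial_succ k]; ring
          _ ≤ _ := Nat.mul_le_mul_left _ this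
    have h2 : partialSurjCount (m + k) m * m ! * k ! ≤ (m + k)! * (m + k)! := by
      simpa using ih m
    rw [show m + k + 1 - (m + 1) = k by omega, partialSurjCount, Nat.add_sub_cancel,
      Nat.factorial_succ (m + k)]
    have hk : k ≤ k * k := Nat.le_mul_self k
    calc _ = (m + 2) * (partialSurjCount (m + k) (m + 1) * (m + 1)! * k !) +
          (m + 1) * (m + 1) * (partialSurjCount (m + k) m * m ! * k !) := by
            rw [Nat.factorial_succ m]; ring
      _ ≤ (m + 2) * (k * ((m + k)! * (m + k)!)) +
          (m + 1) * (m + 1) * ((m + k)! * (m + k)!) := by gcongr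
      _ = ((m + 2) * k + (m + 1) * (m + 1)) * ((m + k)! * (m + k)!) := by ring
      _ ≤ ((m + k + 1) * (m + k + 1)) * ((m + k)! * (m + k)!) := by
            refine Nat.mul_le_mul_right _ ?_
            nlinarith
      _ = _ := by ring

open Nat in
lemma sum_range_two_pow_div_factorial_le (n : ℕ) :
    ∑ m ∈ Finset.range (n + 1), (2 : ℝ) ^ (n - m) / (n - m)! ≤ Real.exp 2 := by
  have := Finset.sum_range_reflect (fun k => (2 : ℝ) ^ k / k !) (n + 1)
  simp only [Nat.add_sub_cancel] at this
  rw [this]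
  exact Real.sum_le_exp_of_nonneg (by norm_num) _

open Nat in
lemma factorial_mul_partialSurjCount_le {n m : ℕ} :
    ((m ! * partialSurjCount n m : ℕ) : ℝ) ≤
      (n ! * n ! : ℝ) * ((2 : ℝ) ^ (n - m) / (n - m)!) := by
  have h : ((partialSurjCount n m * m ! * (n - m)! : ℕ) : ℝ) ≤ ((n ! * n ! : ℕ) : ℝ) := by
    exact_mod_cast partialSurjCount_mul_le n m
  push_cast at h ⊢
  have hp : (1 : ℝ) ≤ 2 ^ (n - m) := one_le_pow₀ (by norm_num)
  rw [← mul_div_assoc, le_div_iff₀ (by positivity)]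
  calc _ = (partialSurjCount n m * m ! * (n - m)! : ℝ) := by ring
    _ ≤ n ! * n ! := h
    _ ≤ _ := le_mul_of_one_le_right (by positivity) hp

open Nat in
lemma factorial_pred_mul_partialSurjCount_le {n m : ℕ} (hn : 1 ≤ n) (hm : m ≤ n) :
    (((m - 1)! * partialSurjCount n m : ℕ) : ℝ) ≤
      (n ! * (n - 1)! : ℝ) * ((2 : ℝ) ^ (n - m) / (n - m)!) := by
  rw [← mul_div_assoc, le_div_iff₀ (by positivity)]
  norm_cast
  rcases m with _ | m
  · simp only [partialSurjCount_zero_right, Nat.zero_sub, Nat.factorial_zero, one_mul, Nat.sub_zero]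
    rw [mul_assoc]
    exact Nat.le_mul_of_pos_right _ (by positivity)
  obtain ⟨k, rfl⟩ := Nat.exists_eq_add_of_le hm
  have h := partialSurjCount_mul_le (m + 1 + k) (m + 1)
  rw [show m + 1 + k - (m + 1) = k by omega] at h ⊢
  rw [show m + 1 + k - 1 = m + k by omega, Nat.add_sub_cancel]
  have hf : (m + 1 + k)! = (m + k + 1) * (m + k)! := by
    rw [show m + 1 + k = m + k + 1 by omega, Nat.factorial_succ]
  have hk : k + 1 ≤ 2 ^ k := Nat.lt_two_pow_self
  refine _root_.le_of_mul_le_mul_left (a := m + 1) ?_ (Nat.succ_pos m)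
  calc _ = partialSurjCount (m + 1 + k) (m + 1) * (m + 1)! * k ! := by
        rw [Nat.factorial_succ m]; ring
    _ ≤ (m + 1 + k)! * (m + 1 + k)! := h
    _ = (m + k + 1) * ((m + 1 + k)! * (m + k)!) := by
        nth_rewrite 2 [hf]; ring
    _ ≤ ((m + 1) * (k + 1)) * ((m + 1 + k)! * (m + k)!) := by
        refine Nat.mul_le_mul_right _ ?_
        nlinarith
    _ ≤ ((m + 1) * 2 ^ k) * ((m + 1 + k)! * (m + k)!) := by gcongr
    _ = _ := by ring

end Counting

section Hosts

variable {Q : Type*} {d : PreHT Q}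

/-- `v` is a deepest node whose label contains `q`. -/
def IsHost (d : PreHT Q) (q : Q) (v : RNode) : Prop :=
  q ∈ d.lab v ∧ ∀ i : ℕ, q ∉ d.lab (v ++ [i])

lemma IsOLT.mem_dom (hd : IsOLT d) {v : RNode} {q : Q} (h : q ∈ d.lab v) : v ∈ d.dom := by
  by_contra hv
  rw [hd.2.2.1 v hv] at h
  exact h

lemma IsOLT.mem_lab_of_append (hd : IsOLT d) {q : Q} (u w : RNode) :
    q ∈ d.lab (u ++ w) → q ∈ d.lab u := by
  induction w using List.reverseRecOn with
  | nil => simp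
  | append_singleton w i ih =>
    intro h
    rw [← List.append_assoc] at h
    exact ih (hd.2.2.2.1 _ _ (hd.mem_dom h) h)

lemma IsOLT.mem_lab_of_prefix (hd : IsOLT d) {q : Q} {u w : RNode} (h : u <+: w)
    (hq : q ∈ d.lab w) : q ∈ d.lab u := by
  obtain ⟨t, rfl⟩ := h
  exact hd.mem_lab_of_append u t hq

lemma IsOLT.eq_of_mem_lab (hd : IsOLT d) {q : Q} {v : RNode} {i j : ℕ}
    (hi : q ∈ d.lab (v ++ [i])) (hj : q ∈ d.lab (v ++ [j])) : i = j := by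
  by_contra h
  exact Set.disjoint_left.1 (hd.2.2.2.2 v i j h) hi hj

lemma IsOLT.host_unique (hd : IsOLT d) {q : Q} (u : RNode) : ∀ (p w : RNode),
    IsHost d q (p ++ u) → IsHost d q (p ++ w) → u = w := by
  induction u with
  | nil =>
    rintro p (_ | ⟨b, w⟩) hu hw
    · rfl
    · rw [List.append_nil] at hu
      rw [List.append_cons] at hw
      exact absurd (hd.mem_lab_of_append _ _ hw.1) (hu.2 b)
  | cons a u ih =>
    rintro p (_ | ⟨b, w⟩) hu hw
    · rw [List.append_nil] at hw
      rw [List.append_cons] at hu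
      exact absurd (hd.mem_lab_of_append _ _ hu.1) (hw.2 a)
    · rw [List.append_cons] at hu hw
      obtain rfl := hd.eq_of_mem_lab (hd.mem_lab_of_append _ _ hu.1)
        (hd.mem_lab_of_append _ _ hw.1)
      rw [ih _ _ hu hw]

lemma IsOLT.exists_host (hd : IsOLT d) {q : Q} {v : RNode} (hq : q ∈ d.lab v) :
    ∃ w, v <+: w ∧ IsHost d q w := by
  have hfin : {w | v <+: w ∧ q ∈ d.lab w}.Finite :=
    hd.1.1.subset fun w hw => hd.mem_dom hw.2
  obtain ⟨w, ⟨hvw, hw⟩, hmax⟩ :=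
    Set.exists_max_image _ List.length hfin ⟨v, List.prefix_rfl, hq⟩
  refine ⟨w, hvw, hw, fun i hi => ?_⟩
  have := hmax (w ++ [i]) ⟨hvw.trans (List.prefix_append _ _), hi⟩
  simp at this

lemma IsRHT.host_ne_nil (hd : IsRHT d) {q : Q} {v : RNode} (h : IsHost d q v) : v ≠ [] := by
  rintro rfl
  have h1 := h.1
  rw [hd.2.2, Set.mem_iUnion] at h1
  obtain ⟨i, hi⟩ := h1
  exact h.2 i hi

end Hosts

section Encoding

variable {n : ℕ}

/-- `c` records the length of `p.2`, the position in `[] :: p.2` of the parent of each node in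
`p.2`, and the position in `p.2` of the host of each state. -/
def IsCode (p : PreHT (Fin n) × List RNode)
    (c : Σ m : ℕ, (Fin m → ℕ) × (Fin n → Option (Fin m))) : Prop :=
  p.2.length = c.1 ∧
  (∀ k : Fin c.1, c.2.1 k ≤ k ∧ ([] :: p.2)[c.2.1 k]? = (p.2[(k : ℕ)]?).map List.dropLast) ∧
  ∀ q k, c.2.2 q = some k ↔ ∃ v, p.2[(k : ℕ)]? = some v ∧ IsHost p.1 q v

lemma IsLIROfRHT.older_sibling {d : PreHT (Fin n)} {ord : List RNode} (hd : IsOLT d)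
    (h : IsLIROfRHT d ord) {u : RNode} {i j k : ℕ} (hk : ord[k]? = some (u ++ [i]))
    (hj : j < i) : ∃ k' < k, ord[k']? = some (u ++ [j]) := by
  obtain ⟨hkl, hk⟩ := List.getElem?_eq_some_iff.1 hk
  have hdom : u ++ [i] ∈ d.dom := ((h.2.1 _).1 (hk ▸ List.getElem_mem hkl)).1
  obtain ⟨k', hl, hlt, he⟩ := h.2.2 k hkl (u ++ [j])
    (Or.inr ⟨u, i, j, hj, rfl, hk⟩) (hd.1.2.2.2 u i hdom j hj)
  exact ⟨k', hlt, List.getElem?_eq_some_iff.2 ⟨hl, he⟩⟩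

lemma IsLIROfRHT.exists_parent {d : PreHT (Fin n)} {ord : List RNode} (hd : IsOLT d)
    (h : IsLIROfRHT d ord) {k : ℕ} (hk : k < ord.length) :
    ∃ j ≤ k, ([] :: ord)[j]? = (ord[k]?).map List.dropLast := by
  have hv := (h.2.1 _).1 (List.getElem_mem hk)
  rw [List.getElem?_eq_getElem hk, Option.map_some]
  by_cases h0 : ord[k].dropLast = []
  · exact ⟨0, Nat.zero_le _, by simp [h0]⟩
  · have hne : ord[k].dropLast ≠ ord[k] := by
      intro e
      have := congrArg List.length e
      have h1 := List.length_pos_iff.2 hv.2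
      rw [List.length_dropLast] at this
      omega
    obtain ⟨k', hl, hlt, he⟩ := h.2.2 k hk ord[k].dropLast
      (Or.inl ⟨List.dropLast_prefix _, hne, h0⟩)
      (hd.1.2.2.1 _ hv.1 _ (List.dropLast_prefix _))
    exact ⟨k' + 1, hlt, by simpa using List.getElem?_eq_some_iff.2 ⟨hl, he⟩⟩

lemma exists_isCode {p : PreHT (Fin n) × List RNode} (h1 : IsRHT p.1)
    (h2 : IsLIROfRHT p.1 p.2) :
    ∃ c, IsCode p c ∧ ∀ k, ∃ q, c.2.2 q = some k := by
  have hpar : ∀ k : Fin p.2.length, ∃ j ≤ (k : ℕ),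
      ([] :: p.2)[j]? = (p.2[(k : ℕ)]?).map List.dropLast :=
    fun k => h2.exists_parent h1.1 k.2
  choose par hpar using hpar
  have hhost : ∀ q, ∃ o : Option (Fin p.2.length), ∀ k,
      o = some k ↔ ∃ v, p.2[(k : ℕ)]? = some v ∧ IsHost p.1 q v := by
    intro q
    by_cases hq : ∃ v, IsHost p.1 q v
    · obtain ⟨v, hv⟩ := hq
      have hm : v ∈ p.2 := (h2.2.1 v).2 ⟨h1.1.mem_dom hv.1, h1.host_ne_nil hv⟩
      obtain ⟨k, hk, rfl⟩ := List.getElem_of_mem hm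
      refine ⟨some ⟨k, hk⟩, fun j => ⟨?_, ?_⟩⟩
      · rintro h
        obtain rfl := Option.some.inj h
        exact ⟨_, List.getElem?_eq_getElem hk, hv⟩
      · rintro ⟨w, hw, hwh⟩
        obtain rfl := h1.1.host_unique _ [] _ hv hwh
        obtain ⟨hj, he⟩ := List.getElem?_eq_some_iff.1 hw
        congr 1
        exact Fin.ext ((h2.1.getElem_inj_iff).1 he.symm)
    · refine ⟨none, fun k => ⟨by simp, ?_⟩⟩
      rintro ⟨v, _, hv⟩
      exact absurd ⟨v, hv⟩ hq
  choose host hhost using hhost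
  refine ⟨⟨p.2.length, par, host⟩, ⟨rfl, hpar, hhost⟩, fun k => ?_⟩
  have hv := (h2.2.1 _).1 (List.getElem_mem k.2)
  obtain ⟨q, hq⟩ := h1.2.1 _ hv.1 hv.2
  exact ⟨q, (hhost q k).2 ⟨_, List.getElem?_eq_getElem k.2, hq⟩⟩

lemma IsCode.getElem?_eq {p p' : PreHT (Fin n) × List RNode} {c}
    (h1 : IsRHT p.1) (h2 : IsLIROfRHT p.1 p.2) (h1' : IsRHT p'.1) (h2' : IsLIROfRHT p'.1 p'.2)
    (h : IsCode p c) (h' : IsCode p' c) (k : ℕ) : p.2[k]? = p'.2[k]? := by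
  induction k using Nat.strong_induction_on with
  | _ k ih =>
  rcases lt_or_ge k c.1 with hk | hk
  swap
  · rw [List.getElem?_eq_none (h.1 ▸ hk), List.getElem?_eq_none (h'.1 ▸ hk)]
  have hkp : k < p.2.length := h.1 ▸ hk
  have hkp' : k < p'.2.length := h'.1 ▸ hk
  have hpar : p.2[k].dropLast = p'.2[k].dropLast := by
    have e := h.2.1 ⟨k, hk⟩
    have e' := h'.2.1 ⟨k, hk⟩
    have : ([] :: p.2)[c.2.1 ⟨k, hk⟩]? = ([] :: p'.2)[c.2.1 ⟨k, hk⟩]? := by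
      have hle : c.2.1 ⟨k, hk⟩ ≤ k := e.1
      generalize c.2.1 ⟨k, hk⟩ = j at hle
      rcases j with _ | j
      · simp
      · simpa using ih j hle
    rw [e.2, e'.2] at this
    simpa [List.getElem?_eq_getElem hkp, List.getElem?_eq_getElem hkp'] using this
  have hne := ((h2.2.1 _).1 (List.getElem_mem hkp)).2
  have hne' := ((h2'.2.1 _).1 (List.getElem_mem hkp')).2
  have e := List.dropLast_append_getLast hne
  have e' := List.dropLast_append_getLast hne'
  rw [← hpar] at e'
  generalize p.2[k].dropLast = u at e e'
  generalize p.2[k].getLast hne = i at e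
  generalize p'.2[k].getLast hne' = i' at e'
  have g : p.2[k]? = some (u ++ [i]) := by rw [e, List.getElem?_eq_getElem hkp]
  have g' : p'.2[k]? = some (u ++ [i']) := by rw [e', List.getElem?_eq_getElem hkp']
  rcases lt_trichotomy i i' with hi | rfl | hi
  · obtain ⟨k', hlt, hk'⟩ := h2'.older_sibling h1'.1 g' hi
    rw [← ih k' hlt, ← g] at hk'
    exact absurd ((List.getElem?_inj (hlt.trans hkp) h2.1).1 hk') hlt.ne
  · rw [g, g']
  · obtain ⟨k', hlt, hk'⟩ := h2.older_sibling h1.1 g hi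
    rw [ih k' hlt, ← g'] at hk'
    exact absurd ((List.getElem?_inj (hlt.trans hkp') h2'.1).1 hk') hlt.ne

lemma IsCode.mem_lab_iff {p : PreHT (Fin n) × List RNode} {c}
    (h1 : IsRHT p.1) (h2 : IsLIROfRHT p.1 p.2) (h : IsCode p c) (v : RNode) (q : Fin n) :
    q ∈ p.1.lab v ↔ ∃ k, c.2.2 q = some k ∧ ∃ w, p.2[(k : ℕ)]? = some w ∧ v <+: w := by
  constructor
  · intro hq
    obtain ⟨w, hvw, hw⟩ := h1.1.exists_host hq
    have hm : w ∈ p.2 := (h2.2.1 w).2 ⟨h1.1.mem_dom hw.1, h1.host_ne_nil hw⟩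
    obtain ⟨k, hk, rfl⟩ := List.getElem_of_mem hm
    exact ⟨⟨k, h.1 ▸ hk⟩, (h.2.2 _ _).2 ⟨_, List.getElem?_eq_getElem hk, hw⟩, _,
      List.getElem?_eq_getElem hk, hvw⟩
  · rintro ⟨k, hk, w, hw, hvw⟩
    obtain ⟨w', hw', hh⟩ := (h.2.2 _ _).1 hk
    obtain rfl : w = w' := Option.some.inj (hw.symm.trans hw')
    exact h1.1.mem_lab_of_prefix hvw hh.1

lemma IsCode.unique {p p' : PreHT (Fin n) × List RNode} {c}
    (h1 : IsRHT p.1) (h2 : IsLIROfRHT p.1 p.2) (h1' : IsRHT p'.1) (h2' : IsLIROfRHT p'.1 p'.2)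
    (h : IsCode p c) (h' : IsCode p' c) : p = p' := by
  have hord : p.2 = p'.2 := List.ext_getElem? (h.getElem?_eq h1 h2 h1' h2' h')
  have hlab : p.1.lab = p'.1.lab := by
    ext v q
    rw [h.mem_lab_iff h1 h2, h'.mem_lab_iff h1' h2', hord]
  have hdom : ∀ {d : PreHT (Fin n)}, IsRHT d → d.dom = {v | d.lab v ≠ ∅} := by
    intro d hd
    ext v
    exact ⟨hd.1.2.1 v, fun hv => by_contra fun hn => hv (hd.1.2.2.1 v hn)⟩
  have hd : p.1.dom = p'.1.dom := by rw [hdom h1, hdom h1', hlab]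
  obtain ⟨⟨_, _⟩, _⟩ := p
  obtain ⟨⟨_, _⟩, _⟩ := p'
  simp_all

/-- If the admissible parent positions of the `k`-th node are confined to `w k`, the pairs of a
root history tree and an LIR are counted by the choices of parent positions and hosts. -/
lemma card_lir_rht_le (P : PreHT (Fin n) × List RNode → Prop) (w : ℕ → Finset ℕ)
    (hP : ∀ p c, P p → IsRHT p.1 → IsLIROfRHT p.1 p.2 → IsCode p c →
      ∀ k : Fin c.1, c.2.1 k ∈ w k) :
    Nat.card {p : PreHT (Fin n) × List RNode // IsRHT p.1 ∧ IsLIROfRHT p.1 p.2 ∧ P p} ≤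
      ∑ m ∈ Finset.range (n + 1), (∏ k ∈ Finset.range m, (w k).card) * partialSurjCount n m := by
  let S : Finset (Σ m : ℕ, (Fin m → ℕ) × (Fin n → Option (Fin m))) :=
    (Finset.range (n + 1)).sigma fun m =>
      (Fintype.piFinset fun k : Fin m => w k) ×ˢ
        Finset.univ.filter fun h => ∀ a, ∃ q, h q = some a
  have hex : ∀ p : {p : PreHT (Fin n) × List RNode // IsRHT p.1 ∧ IsLIROfRHT p.1 p.2 ∧ P p},
      ∃ c : S, IsCode p.1 c.1 := by
    rintro ⟨p, h1, h2, h3⟩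
    obtain ⟨c, hc, hcov⟩ := exists_isCode h1 h2
    refine ⟨⟨c, ?_⟩, hc⟩
    simp only [S, Finset.mem_sigma, Finset.mem_range, Finset.mem_product, Fintype.mem_piFinset,
      Finset.mem_filter, Finset.mem_univ, true_and]
    refine ⟨?_, hP p c h3 h1 h2 hc, hcov⟩
    choose f hf using hcov
    have := Fintype.card_le_of_injective f fun a b hab =>
      Option.some.inj (by rw [← hf a, ← hf b, hab])
    simp only [Fintype.card_fin] at this
    omega
  choose f hf using hex
  have hinj : Function.Injective f := fun p p' hpp => Subtype.ext <|
    (hf p).unique p.2.1 p.2.2.1 p'.2.1 p'.2.2.1 (by rw [hpp]; exact hf p')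
  refine (Nat.card_le_card_of_injective f hinj).trans ?_
  rw [Nat.card_eq_fintype_card, Fintype.card_coe, Finset.card_sigma]
  refine Finset.sum_le_sum fun m _ => ?_
  rw [Finset.card_product, Fintype.card_piFinset, Finset.prod_range]
  refine Nat.mul_le_mul_left _ ?_
  have := card_partialSurj_le n (Fin m)
  rwa [Nat.card_eq_fintype_card, Fintype.card_subtype, Fintype.card_fin] at this

/-- When the root and its first child have the same label, only the first node of the record is a
child of the root. -/
lemma IsCode.parent_pos {p : PreHT (Fin n) × List RNode} {c} (h1 : IsRHT p.1)
    (h2 : IsLIROfRHT p.1 p.2) (h3 : p.1.lab [0] = p.1.lab []) (h : IsCode p c)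
    (k : Fin c.1) (hk : (k : ℕ) ≠ 0) : c.2.1 k ≠ 0 := by
  have hchild : ∀ (j : ℕ) (hj : j < p.2.length), p.2[j].dropLast = [] → p.2[j] = [0] := by
    intro j hj hd
    have hv := (h2.2.1 _).1 (List.getElem_mem hj)
    have e := List.dropLast_append_getLast hv.2
    rw [hd, List.nil_append] at e
    generalize p.2[j].getLast hv.2 = i at e
    rw [← e] at hv ⊢
    obtain ⟨q, hq⟩ := Set.nonempty_iff_ne_empty.2 (h1.1.2.1 _ hv.1)
    have hq0 : q ∈ p.1.lab ([] ++ [0]) := by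
      rw [List.nil_append, h3]
      exact h1.1.mem_lab_of_append [] [i] hq
    rw [h1.1.eq_of_mem_lab (v := []) hq hq0]
  have hkl : (k : ℕ) < p.2.length := k.2.trans_eq h.1.symm
  have h0l : 0 < p.2.length := by omega
  intro hc
  have hk2 := (h.2.1 k).2
  rw [hc, List.getElem?_eq_getElem hkl] at hk2
  have hk3 := hchild k hkl (by simpa using hk2.symm)
  obtain ⟨j, hj, hj2⟩ := h2.exists_parent h1.1 h0l
  obtain rfl : j = 0 := by omega
  rw [List.getElem?_eq_getElem h0l] at hj2
  have h03 := hchild 0 h0l (by simpa using hj2.symm)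
  exact hk (h2.1.getElem_inj_iff.1 (hk3.trans h03.symm))

end Encoding

open Nat in
lemma lirRhtCount_le (n : ℕ) :
    lirRhtCount n ≤ ∑ m ∈ Finset.range (n + 1), m ! * partialSurjCount n m := by
  have := card_lir_rht_le (n := n) (fun _ => True) (fun k => Finset.range (k + 1))
    (fun p c _ _ _ hc k => Finset.mem_range_succ_iff.2 (hc.2.1 k).1)
  simpa [lirRhtCount, Finset.prod_range_add_one_eq_factorial] using this

open Nat in
lemma lirRhtBuchiCount_le (n : ℕ) :
    lirRhtBuchiCount n ≤ ∑ m ∈ Finset.range (n + 1), (m - 1)! * partialSurjCount n m := by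
  have hw : ∀ m, ∏ k ∈ Finset.range m, (if k = 0 then {0} else Finset.Icc 1 k : Finset ℕ).card =
      (m - 1)! := by
    rintro (_ | m)
    · simp
    · simp [Finset.prod_range_succ', Finset.prod_range_add_one_eq_factorial]
  have := card_lir_rht_le (n := n) (fun p => p.1.lab [0] = p.1.lab [])
    (fun k => if k = 0 then {0} else Finset.Icc 1 k) (fun p c h3 h1 h2 hc k => by
      have hle := (hc.2.1 k).1
      split_ifs with hk
      · simp; omega
      · have := hc.parent_pos h1 h2 h3 k hk
        simp; omega)
  simpa only [lirRhtBuchiCount, hw] using this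

/-- The deterministic parity automaton obtained via the LIR
construction from a nondeterministic one-pair Rabin automaton with `n` states
has `O(n!²)` states, and `O(n!·(n−1)!)` states if the input automaton is a
Büchi automaton. -/
theorem lir_parity_automaton_size :
    ∃ K : ℝ, 0 < K ∧ ∀ n : ℕ, 1 ≤ n →
      (lirRhtCount n : ℝ) ≤ K * (Nat.factorial n) * (Nat.factorial n) ∧
      (lirRhtBuchiCount n : ℝ) ≤ K * (Nat.factorial n) * (Nat.factorial (n - 1)) := by
  have bound : ∀ (n : ℕ) (c : ℝ) (a : ℕ → ℕ) (N : ℕ), 0 ≤ c →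
      N ≤ ∑ m ∈ Finset.range (n + 1), a m →
      (∀ m ≤ n, (a m : ℝ) ≤ c * ((2 : ℝ) ^ (n - m) / (n - m).factorial)) →
      (N : ℝ) ≤ c * Real.exp 2 := by
    intro n c a N hc hN ha
    calc (N : ℝ) ≤ ∑ m ∈ Finset.range (n + 1), (a m : ℝ) := by exact_mod_cast hN
      _ ≤ ∑ m ∈ Finset.range (n + 1), c * ((2 : ℝ) ^ (n - m) / (n - m).factorial) :=
          Finset.sum_le_sum fun m hm => ha m (Finset.mem_range_succ_iff.1 hm)
      _ ≤ c * Real.exp 2 := by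
          rw [← Finset.mul_sum]
          exact mul_le_mul_of_nonneg_left (sum_range_two_pow_div_factorial_le n) hc
  refine ⟨Real.exp 2, Real.exp_pos 2, fun n hn => ⟨?_, ?_⟩⟩
  · rw [mul_assoc, mul_comm]
    exact bound n _ _ _ (by positivity) (lirRhtCount_le n)
      fun m _ => factorial_mul_partialSurjCount_le
  · rw [mul_assoc, mul_comm]
    exact bound n _ _ _ (by positivity) (lirRhtBuchiCount_le n)
      fun m hm => factorial_pred_mul_partialSurjCount_le hn hm
end
end

section
/- Let 𝒜 be a deterministic Rabin, Streett, parity, or more generally Muller automaton with initial state s₀ that recognises the language of the full parity automaton 𝓟ₙᶜ or its complement. If finite words u and v lead 𝒜 from s₀ to the same state s, then reach(u) = reach(v), or ⊤ ∈ reach(u) and ⊤ ∈ reach(v). -/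
noncomputable section
open scoped Classical

/-- `f` takes a value in `s` infinitely often. -/
def InfOft {β : Type*} (f : ℕ → β) (s : Set β) : Prop := {i | f i ∈ s}.Infinite

/-- A nondeterministic parity automaton with transition-based priorities in `[c]`. -/
structure NPA (Q A : Type*) where
  init : Set Q
  tr : Set (Q × A × Q)
  pri : Q × A × Q → ℕ
  c : ℕ

namespace NPA

variable {Q A : Type*} (M : NPA Q A)

/-- `ρ` is a run of `M` on `α`. -/
def IsRun (α : ℕ → A) (ρ : ℕ → Q) : Prop :=
  ρ 0 ∈ M.init ∧ ∀ i, (ρ i, α i, ρ (i + 1)) ∈ M.tr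

/-- The highest priority occurring infinitely often on the transitions of `ρ` is even. -/
def ParityAccept (α : ℕ → A) (ρ : ℕ → Q) : Prop :=
  ∃ p, Even p ∧ InfOft (fun i => M.pri (ρ i, α i, ρ (i + 1))) {p} ∧
    ∀ q > p, ¬ InfOft (fun i => M.pri (ρ i, α i, ρ (i + 1))) {q}

/-- The language of a nondeterministic parity automaton. -/
def Lang : Set (ℕ → A) := {α | ∃ ρ, M.IsRun α ρ ∧ M.ParityAccept α ρ}

/-- `e`: the largest even number `≤ c`. -/
def e : ℕ := 2 * (M.c / 2)

/-- The rejecting transitions of level `a`: odd priority `> a`. -/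
def Ra (a : ℕ) : Set (Q × A × Q) := {t ∈ M.tr | a < M.pri t ∧ Odd (M.pri t)}

/-- The accepting transitions of level `a`: even priority `≥ a`. -/
def Aa (a : ℕ) : Set (Q × A × Q) := {t ∈ M.tr | a ≤ M.pri t ∧ Even (M.pri t)}

/-- The (at least) neutral transitions of level `a`. -/
def Na (a : ℕ) : Set (Q × A × Q) := M.tr \ M.Ra a

end NPA

/-! ### The full parity automaton `𝓟ₙᶜ` -/

/-- The alphabet `Σₙᶜ` of the full parity automaton: functions from
`Q × Q^⊤` to sets of priorities in `[c]` (the element `i : Fin c` represents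
the priority `i + 1`); `Q = Fin n` and `Q^⊤ = Option (Fin n)` with the
accepting sink `⊤` represented by `none`. -/
abbrev FullAlpha (n c : ℕ) := Fin n × Option (Fin n) → Finset (Fin c)

/-- `opt`: the greatest even element of a set of priorities, or its least
element (which is then its least odd element) if it contains no even one. -/
def optPri (s : Finset ℕ) : ℕ :=
  if h : (s.filter (fun x => Even x)).Nonempty then (s.filter (fun x => Even x)).max' h
  else if h2 : s.Nonempty then s.min' h2 else 0

/-- The transitions of the full parity automaton: `(q, σ, x)` whenever
`σ(q,x) ≠ ∅`, and the self-loop at the accepting sink `⊤`. -/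
def fullTrans (n c : ℕ) : Set (Option (Fin n) × FullAlpha n c × Option (Fin n)) :=
  {t | (∃ q : Fin n, t.1 = some q ∧ (t.2.1 (q, t.2.2)) ≠ ∅) ∨ (t.1 = none ∧ t.2.2 = none)}

/-- The priority of a transition: `opt (σ (q, q'))`; the loop at the sink `⊤`
carries the (even) priority `2⌊c/2⌋`, making every run that reaches `⊤`
accepting. -/
def fullPri (n c : ℕ) (t : Option (Fin n) × FullAlpha n c × Option (Fin n)) : ℕ :=
  match t.1 with
  | some q => optPri ((t.2.1 (q, t.2.2)).image (fun i : Fin c => (i : ℕ) + 1))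
  | none => 2 * (c / 2)

/-- The full parity automaton `𝓟ₙᶜ` with `n` states and priorities in `[c]`. -/
def FullNPA (n c : ℕ) : NPA (Option (Fin n)) (FullAlpha n c) :=
  { init := {x | x ≠ none}, tr := fullTrans n c, pri := fullPri n c, c := c }

/-- The language of the full parity automaton `𝓟ₙᶜ`. -/
def FullLang (n c : ℕ) : Set (ℕ → FullAlpha n c) := (FullNPA n c).Lang

/-- `reach(u)`: the set of states of `𝓟ₙᶜ` (including possibly `⊤ = none`)
reachable from the initial states on the finite word `u`. -/
def reachL (n c : ℕ) (u : List (FullAlpha n c)) : Set (Option (Fin n)) :=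
  u.foldl (fun S a => {x | ∃ q ∈ S, (q, a, x) ∈ fullTrans n c}) {x | x ≠ none}

/-- A deterministic (complete) automaton with transition-based Muller
acceptance: a run is accepting iff the set of transitions it takes infinitely
often belongs to `accSets`.  Rabin, Streett and parity automata are special
cases. -/
structure DetMuller (S A : Type*) where
  s0 : S
  δ : S → A → S
  accSets : Set (Set (S × A × S))

namespace DetMuller

variable {S A : Type*} (M : DetMuller S A)

/-- The run of `M` on the ω-word `α`. -/
def run (α : ℕ → A) : ℕ → S
  | 0 => M.s0
  | i + 1 => M.δ (run α i) (α i)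

/-- The language of a deterministic Muller automaton. -/
def Lang : Set (ℕ → A) :=
  {α | {t | InfOft (fun i => (M.run α i, α i, M.run α (i + 1))) {t}} ∈ M.accSets}

/-- The state reached on a finite word. -/
def runList (u : List A) : S := u.foldl M.δ M.s0

end DetMuller

theorem infOft_shift {β : Type*} (f : ℕ → β) (s : Set β) :
    InfOft (fun i => f (i + 1)) s ↔ InfOft f s := by
  simp only [InfOft, ← Nat.frequently_atTop_iff_infinite]
  conv_rhs => rw [← Filter.map_add_atTop_eq_nat 1, Filter.frequently_map]

namespace NPA

variable {Q A : Type*} (M : NPA Q A)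

/-- The automaton `M` with its set of initial states replaced by `I`. -/
def withInit (I : Set Q) : NPA Q A := { M with init := I }

/-- The successors of the set of states `I` on the letter `a`. -/
def step (I : Set Q) (a : A) : Set Q := {x | ∃ q ∈ I, (q, a, x) ∈ M.tr}

theorem parityAccept_shift (α : ℕ → A) (ρ : ℕ → Q) :
    M.ParityAccept (fun i => α (i + 1)) (fun i => ρ (i + 1)) ↔ M.ParityAccept α ρ := by
  unfold ParityAccept
  simp only [infOft_shift (fun i => M.pri (ρ i, α i, ρ (i + 1)))]

theorem mem_lang_withInit_iff_shift (I : Set Q) (α : ℕ → A) :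
    α ∈ (M.withInit I).Lang ↔ (fun i => α (i + 1)) ∈ (M.withInit (M.step I (α 0))).Lang := by
  constructor
  · rintro ⟨ρ, ⟨h0, hρ⟩, hacc⟩
    exact ⟨fun i => ρ (i + 1), ⟨⟨ρ 0, h0, hρ 0⟩, fun i => hρ (i + 1)⟩,
      (parityAccept_shift _ α ρ).2 hacc⟩
  · rintro ⟨ρ, ⟨⟨q, hq, ht⟩, hρ⟩, hacc⟩
    let ρ' : ℕ → Q := fun i => Nat.casesOn i q ρ
    refine ⟨ρ', ⟨hq, ?_⟩, (parityAccept_shift (M.withInit I) α ρ').1 hacc⟩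
    rintro (_ | i)
    · exact ht
    · exact hρ i

theorem getD_mem_lang_withInit_iff (I : Set Q) (u : List A) (a : A) :
    (fun i => u.getD i a) ∈ (M.withInit I).Lang ↔
      (fun _ => a) ∈ (M.withInit (u.foldl M.step I)).Lang := by
  induction u generalizing I with
  | nil => simp
  | cons b u ih =>
    rw [mem_lang_withInit_iff_shift]
    simpa using ih (M.step I b)

end NPA

namespace DetMuller

variable {S A : Type*} (M : DetMuller S A)

/-- The automaton `M` with its initial state replaced by `s`. -/
def withInit (s : S) : DetMuller S A := { M with s0 := s }

theorem run_withInit_succ (s : S) (α : ℕ → A) (i : ℕ) :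
    (M.withInit s).run α (i + 1) =
      (M.withInit (M.δ s (α 0))).run (fun i => α (i + 1)) i := by
  induction i with
  | zero => rfl
  | succ i ih => exact congrArg (M.δ · (α (i + 1))) ih

theorem mem_lang_withInit_iff_shift (s : S) (α : ℕ → A) :
    α ∈ (M.withInit s).Lang ↔
      (fun i => α (i + 1)) ∈ (M.withInit (M.δ s (α 0))).Lang := by
  simp only [Lang, Set.mem_ofPred_eq, ← run_withInit_succ,
    infOft_shift (fun i => ((M.withInit s).run α i, α i, (M.withInit s).run α (i + 1)))]
  rfl

theorem getD_mem_lang_withInit_iff (s : S) (u : List A) (a : A) :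
    (fun i => u.getD i a) ∈ (M.withInit s).Lang ↔
      (fun _ => a) ∈ (M.withInit (u.foldl M.δ s)).Lang := by
  induction u generalizing s with
  | nil => simp
  | cons b u ih =>
    rw [mem_lang_withInit_iff_shift]
    simpa using ih (M.δ s b)

/-- Two words leading to the same state have the same constant continuations in the language. -/
theorem getD_mem_lang_congr {u v : List A} (h : M.runList u = M.runList v) (a : A) :
    (fun i => u.getD i a) ∈ M.Lang ↔ (fun i => v.getD i a) ∈ M.Lang := by
  change _ ∈ (M.withInit M.s0).Lang ↔ _ ∈ (M.withInit M.s0).Lang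
  rw [getD_mem_lang_withInit_iff, getD_mem_lang_withInit_iff]
  exact iff_of_eq (congrArg (fun s => _ ∈ (M.withInit s).Lang) h)

end DetMuller

/-- The letter whose only transition leads from `x` to the sink (none if `x` is the sink). -/
def toSink {n c : ℕ} (x : Option (Fin n)) : FullAlpha n c :=
  fun p => if some p.1 = x ∧ p.2 = none then Finset.univ else ∅

theorem mem_fullLang_of_sink {n c : ℕ} {I : Set (Option (Fin n))} (hI : none ∈ I)
    (α : ℕ → FullAlpha n c) : α ∈ ((FullNPA n c).withInit I).Lang := by
  refine ⟨fun _ => none, ⟨hI, fun i => Or.inr ⟨rfl, rfl⟩⟩, 2 * (c / 2), even_two_mul _, ?_, ?_⟩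
  · simp [InfOft, NPA.withInit, FullNPA, fullPri, Set.infinite_univ]
  · intro q hq
    simp [InfOft, NPA.withInit, FullNPA, fullPri, hq.ne]

theorem const_toSink_mem_iff {n c : ℕ} (hc : 1 ≤ c) (I : Set (Option (Fin n)))
    (x : Option (Fin n)) :
    (fun _ => toSink x) ∈ ((FullNPA n c).withInit I).Lang ↔ x ∈ I ∨ none ∈ I := by
  constructor
  · rintro ⟨ρ, ⟨h0, hρ⟩, -⟩
    change ρ 0 ∈ I at h0
    obtain ⟨q, hq, hne⟩ | ⟨hq, -⟩ := hρ 0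
    · left
      by_cases hx : some q = x
      · rwa [← hx, ← hq]
      · simp [toSink, hx] at hne
    · right
      rwa [← hq]
  · rintro (hx | hI)
    · cases x with
      | none => exact mem_fullLang_of_sink hx _
      | some q =>
        rw [NPA.mem_lang_withInit_iff_shift]
        have : Nonempty (Fin c) := ⟨⟨0, hc⟩⟩
        have hq : (some q, toSink (some q), none) ∈ fullTrans n c :=
          Or.inl ⟨q, rfl, by simp [toSink, Finset.univ_nonempty.ne_empty]⟩
        exact mem_fullLang_of_sink (I := (FullNPA n c).step I _) ⟨some q, hx, hq⟩ _
    · exact mem_fullLang_of_sink hI _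

theorem getD_toSink_mem_fullLang_iff {n c : ℕ} (hc : 1 ≤ c) (u : List (FullAlpha n c))
    (x : Option (Fin n)) :
    (fun i => u.getD i (toSink x)) ∈ FullLang n c ↔
      x ∈ reachL n c u ∨ none ∈ reachL n c u :=
  ((FullNPA n c).getD_mem_lang_withInit_iff {x | x ≠ none} u (toSink x)).trans
    (const_toSink_mem_iff hc _ x)

/-- Let `𝒜` be a deterministic Rabin, Streett, parity, or
more generally Muller automaton that recognises the language of the full
parity automaton `𝓟ₙᶜ` or its complement.  If finite words `u` and `v` lead
`𝒜` from its initial state to the same state, then `reach(u) = reach(v)`, or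
`⊤ ∈ reach(u)` and `⊤ ∈ reach(v)`. -/
theorem reach_determined_by_state {n c : ℕ} (hn : 1 ≤ n) (hc : 1 ≤ c)
    {S : Type} (M : DetMuller S (FullAlpha n c))
    (hL : M.Lang = FullLang n c ∨ M.Lang = (FullLang n c)ᶜ)
    (u v : List (FullAlpha n c)) (h : M.runList u = M.runList v) :
    reachL n c u = reachL n c v ∨
      (none ∈ reachL n c u ∧ none ∈ reachL n c v) := by
  have key (x : Option (Fin n)) : (x ∈ reachL n c u ∨ none ∈ reachL n c u) ↔
      (x ∈ reachL n c v ∨ none ∈ reachL n c v) := by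
    rw [← getD_toSink_mem_fullLang_iff hc, ← getD_toSink_mem_fullLang_iff hc]
    have hM := M.getD_mem_lang_congr h (toSink x)
    obtain hL | hL := hL
    · rwa [hL] at hM
    · rw [hL] at hM
      exact not_iff_not.1 hM
  have hnone : none ∈ reachL n c u ↔ none ∈ reachL n c v := by simpa using key none
  by_cases hu : none ∈ reachL n c u
  · exact Or.inr ⟨hu, hnone.1 hu⟩
  · have hv := mt hnone.2 hu
    left
    ext x
    simpa [hu, hv] using key x
end
end
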